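/- Clebsch–Bolza–Igusa: Two binary sextics f and g over an algebraically closed field k of characteristic ≠ 2,3,5, both with nonzero discriminant I_10, are GL_2(k)-conjugate if and only if there exists r ≠ 0 in k with I_{2i}(f) = r^{2i} I_{2i}(g) for i = 1, 2, 3, 5. -/

import Mathlib

open MvPolynomial
noncomputable section

/-- The binary form of degree `d` with coefficient vector `a`. -/
def toForm (k : Type*) [CommSemiring k] (d : ℕ) (a : Fin (d+1) → k) :
    MvPolynomial (Fin 2) k :=
  ∑ i : Fin (d+1), C (a i) * X 0 ^ (d - (i : ℕ)) * X 1 ^ (i : ℕ)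

/-- Coordinate change by the matrix `g` : `X ↦ g00 X + g01 Y`, `Y ↦ g10 X + g11 Y`. -/
def matAct (k : Type*) [CommSemiring k] (g : Matrix (Fin 2) (Fin 2) k)
    (p : MvPolynomial (Fin 2) k) : MvPolynomial (Fin 2) k :=
  aeval (fun j : Fin 2 => C (g j 0) * X 0 + C (g j 1) * X 1) p

/-- The coefficient of `X^(d-i) Y^i` in a binary form of degree `d`. -/
def formCoeff (k : Type*) [CommSemiring k] (d : ℕ) (p : MvPolynomial (Fin 2) k)
    (i : Fin (d+1)) : k :=
  coeff (Finsupp.single 0 (d - (i : ℕ)) + Finsupp.single 1 (i : ℕ)) p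

/-- The induced action of a `2×2` matrix on the coefficient vector of a binary form. -/
def actCoeff (k : Type*) [CommSemiring k] (d : ℕ) (g : Matrix (Fin 2) (Fin 2) k)
    (a : Fin (d+1) → k) : Fin (d+1) → k :=
  formCoeff k d (matAct k g (toForm k d a))

/-- `P ∈ k[A_0,…,A_d]` is an `SL₂(k)`-invariant. -/
def SL2Invariant (k : Type*) [CommRing k] (d : ℕ)
    (P : MvPolynomial (Fin (d+1)) k) : Prop :=
  ∀ g : Matrix.SpecialLinearGroup (Fin 2) k, ∀ a : Fin (d+1) → k,
    eval (actCoeff k d (g : Matrix (Fin 2) (Fin 2) k) a) P = eval a P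

/-- The ring `R_d` of `SL₂(k)`-invariants in `k[A_0,…,A_d]`. -/
def Rd (k : Type*) [Field k] (d : ℕ) : Subalgebra k (MvPolynomial (Fin (d+1)) k) where
  carrier := {P | SL2Invariant k d P}
  mul_mem' := fun hP hQ g a => by simp only [map_mul]; rw [hP g a, hQ g a]
  add_mem' := fun hP hQ g a => by simp only [map_add]; rw [hP g a, hQ g a]
  algebraMap_mem' := fun r g a => by simp [SL2Invariant]
open scoped Classical

/-- `D_{ij} = x_i y_j - x_j y_i` for the roots `(x_i , y_i)` of a binary sextic. -/
def Dij {k : Type*} [CommRing k] (x y : Fin 6 → k) (i j : Fin 6) : k :=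
  x i * y j - x j * y i

/-- `Σ D_{ij}² D_{kl}² D_{mn}²`, the sum running over the 15 partitions of `{1,…,6}`
into three pairs (each partition counted 48 times by permutations). -/
def sumPairs {k : Type*} [Field k] (x y : Fin 6 → k) : k :=
  (48 : k)⁻¹ * ∑ σ : Equiv.Perm (Fin 6),
    (Dij x y (σ 0) (σ 1))^2 * (Dij x y (σ 2) (σ 3))^2 * (Dij x y (σ 4) (σ 5))^2

/-- `Σ D_{ij}² D_{jk}² D_{ki}² D_{lm}² D_{mn}² D_{nl}²`, the sum running over the
10 partitions of `{1,…,6}` into two 3-sets (each counted 72 times by permutations). -/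
def sumB {k : Type*} [Field k] (x y : Fin 6 → k) : k :=
  (72 : k)⁻¹ * ∑ σ : Equiv.Perm (Fin 6),
    ((Dij x y (σ 0) (σ 1))^2 * (Dij x y (σ 1) (σ 2))^2 * (Dij x y (σ 2) (σ 0))^2)
    * ((Dij x y (σ 3) (σ 4))^2 * (Dij x y (σ 4) (σ 5))^2 * (Dij x y (σ 5) (σ 3))^2)

/-- The 60-term sum over pairs of matched triangles (each matched configuration
counted 12 times by permutations). -/
def sumC {k : Type*} [Field k] (x y : Fin 6 → k) : k :=
  (12 : k)⁻¹ * ∑ σ : Equiv.Perm (Fin 6),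
    ((Dij x y (σ 0) (σ 1))^2 * (Dij x y (σ 1) (σ 2))^2 * (Dij x y (σ 2) (σ 0))^2)
    * ((Dij x y (σ 3) (σ 4))^2 * (Dij x y (σ 4) (σ 5))^2 * (Dij x y (σ 5) (σ 3))^2)
    * ((Dij x y (σ 0) (σ 3))^2 * (Dij x y (σ 1) (σ 4))^2 * (Dij x y (σ 2) (σ 5))^2)

/-- The basic invariant `I₂` of a binary sextic, expressed through the roots, in the
normalization used by the paper's coefficient formulas. -/
def I2r {k : Type*} [Field k] (x y : Fin 6 → k) : k :=
  -(2 : k)⁻¹ * sumPairs x y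

/-- The basic invariant `I₄` (`= 4I₂² - B` in the paper's normalization of `B`),
expressed through the roots. -/
def I4r {k : Type*} [Field k] (x y : Fin 6 → k) : k :=
  9 * (I2r x y)^2 - 80 * sumB x y

/-- The basic invariant `I₆` (`= 8I₂³ - 160 I₂ I₄ - C` in the paper's normalization
of `C`), expressed through the roots. -/
def I6r {k : Type*} [Field k] (x y : Fin 6 → k) : k :=
  (13/108 : k) * (I2r x y)^3 - (1/108 : k) * I2r x y * I4r x y + (25/9 : k) * sumC x y

/-- The discriminant `I₁₀ = ∏_{i<j} D_{ij}²`. -/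
def I10r {k : Type*} [Field k] (x y : Fin 6 → k) : k :=
  ∏ p ∈ Finset.univ.filter (fun p : Fin 6 × Fin 6 => p.1 < p.2), (Dij x y p.1 p.2)^2

/-- The coefficient of `X^(6-j) Y^j` in the sextic `∏ (y_i X - x_i Y)`. -/
def sexticCoeff {k : Type*} [Field k] (x y : Fin 6 → k) (j : Fin 7) : k :=
  formCoeff k 6 (∏ i : Fin 6,
    (MvPolynomial.C (y i) * MvPolynomial.X 0 - MvPolynomial.C (x i) * MvPolynomial.X 1)) j

/-- The multiplicity of the `i`-th root among the six roots of the sextic. -/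
def rootMult {k : Type*} [Field k] (x y : Fin 6 → k) (i : Fin 6) : ℕ :=
  (Finset.univ.filter (fun j => x i * y j = x j * y i)).card
set_option maxHeartbeats 4000000
set_option maxRecDepth 100000
lemma perm_sum_succ {k : Type*} [AddCommMonoid k] (n : ℕ) (F : (Fin (n+1) → Fin (n+1)) → k) :
    ∑ σ : Equiv.Perm (Fin (n+1)), F σ =
      ∑ p : Fin (n+1), ∑ e : Equiv.Perm (Fin n), F (Fin.cons p (fun i => p.succAbove (e i))) := by
  rw [← Fintype.sum_prod_type']
  symm
  refine Fintype.sum_bijective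
    (fun q : Fin (n+1) × Equiv.Perm (Fin n) =>
      Equiv.ofBijective (Fin.cons q.1 (fun i => q.1.succAbove (q.2 i)) : Fin (n+1) → Fin (n+1)) ?_) ?_ _ _ ?_
  · refine (Finite.injective_iff_bijective).1 ?_
    rw [Fin.cons_injective_iff]
    refine ⟨?_, ?_⟩
    · rintro ⟨i, hi⟩
      exact Fin.succAbove_ne _ _ hi
    · exact (Fin.succAbove_right_injective).comp q.2.injective
  · rw [Fintype.bijective_iff_injective_and_card]
    constructor
    · rintro ⟨p, e⟩ ⟨p', e'⟩ h
      have h' : (Fin.cons p (fun i => p.succAbove (e i)) : Fin (n+1) → Fin (n+1)) =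
        Fin.cons p' (fun i => p'.succAbove (e' i)) := by
        funext i; exact congrArg (fun s : Equiv.Perm (Fin (n+1)) => s i) h
      rw [Fin.cons_inj] at h'
      obtain ⟨rfl, h2⟩ := h'
      congr 1
      ext i : 1
      exact Fin.succAbove_right_injective (congrFun h2 i)
    · simp [Fintype.card_perm, Nat.factorial]
  · intro q; rfl

lemma perm_sum2 {k : Type*} [AddCommMonoid k] (F : Fin 2 → Fin 2 → k) :
    ∑ σ : Equiv.Perm (Fin 2), F (σ 0) (σ 1) = F 0 1 + F 1 0 := by
  rw [perm_sum_succ 1 (fun s => F (s 0) (s 1))]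
  simp [Fin.sum_univ_succ]
lemma perm_sum3 {k : Type*} [AddCommMonoid k] (F : Fin 3 → Fin 3 → Fin 3 → k) :
    ∑ σ : Equiv.Perm (Fin 3), F (σ 0) (σ 1) (σ 2) = 
    ∑ p : Fin 3, (F p (p.succAbove 0) (p.succAbove 1) + F p (p.succAbove 1) (p.succAbove 0)) := by
  rw [perm_sum_succ 2 (fun s => F (s 0) (s 1) (s 2))]
  refine Finset.sum_congr rfl fun p _ => ?_
  exact perm_sum2 (fun a b => F p (p.succAbove a) (p.succAbove b))
lemma perm_sum3' {k : Type*} [AddCommMonoid k] (F : Fin 3 → Fin 3 → Fin 3 → k) :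
    ∑ σ : Equiv.Perm (Fin 3), F (σ 0) (σ 1) (σ 2) =
      F 0 1 2 + F 0 2 1 + (F 1 0 2 + F 1 2 0) + (F 2 0 1 + F 2 1 0) := by
  rw [perm_sum3, Fin.sum_univ_three]; rfl
lemma perm_sum4 {k : Type*} [AddCommMonoid k] (F : Fin 4 → Fin 4 → Fin 4 → Fin 4 → k) :
    ∑ σ : Equiv.Perm (Fin 4), F (σ 0) (σ 1) (σ 2) (σ 3) =
    ∑ p : Fin 4, ∑ e : Equiv.Perm (Fin 3),
       F p (p.succAbove (e 0)) (p.succAbove (e 1)) (p.succAbove (e 2)) := 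
  perm_sum_succ 3 (fun s => F (s 0) (s 1) (s 2) (s 3))
lemma perm_sum5 {k : Type*} [AddCommMonoid k] (F : Fin 5 → Fin 5 → Fin 5 → Fin 5 → Fin 5 → k) :
    ∑ σ : Equiv.Perm (Fin 5), F (σ 0) (σ 1) (σ 2) (σ 3) (σ 4) =
    ∑ p : Fin 5, ∑ e : Equiv.Perm (Fin 4),
       F p (p.succAbove (e 0)) (p.succAbove (e 1)) (p.succAbove (e 2)) (p.succAbove (e 3)) := 
  perm_sum_succ 4 (fun s => F (s 0) (s 1) (s 2) (s 3) (s 4))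
lemma perm_sum6 {k : Type*} [AddCommMonoid k] (F : Fin 6 → Fin 6 → Fin 6 → Fin 6 → Fin 6 → Fin 6 → k) :
    ∑ σ : Equiv.Perm (Fin 6), F (σ 0) (σ 1) (σ 2) (σ 3) (σ 4) (σ 5) =
    ∑ p : Fin 6, ∑ e : Equiv.Perm (Fin 5),
       F p (p.succAbove (e 0)) (p.succAbove (e 1)) (p.succAbove (e 2)) (p.succAbove (e 3)) (p.succAbove (e 4)) := 
  perm_sum_succ 5 (fun s => F (s 0) (s 1) (s 2) (s 3) (s 4) (s 5))

/-- Explicit 15-term sum over synthemes. -/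
def eA {k : Type*} [CommRing k] (g : Fin 6 → Fin 6 → k) : k :=
      g 0 1*g 2 3*g 4 5 +
      g 0 1*g 2 4*g 3 5 +
      g 0 1*g 2 5*g 3 4 +
      g 0 2*g 1 3*g 4 5 +
      g 0 2*g 1 4*g 3 5 +
      g 0 2*g 1 5*g 3 4 +
      g 0 3*g 1 2*g 4 5 +
      g 0 3*g 1 4*g 2 5 +
      g 0 3*g 1 5*g 2 4 +
      g 0 4*g 1 2*g 3 5 +
      g 0 4*g 1 3*g 2 5 +
      g 0 4*g 1 5*g 2 3 +
      g 0 5*g 1 2*g 3 4 +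
      g 0 5*g 1 3*g 2 4 +
      g 0 5*g 1 4*g 2 3

/-- Explicit 10-term sum over pairs of triangles. -/
def eB {k : Type*} [CommRing k] (g : Fin 6 → Fin 6 → k) : k :=
      g 0 1*g 0 2*g 1 2*g 3 4*g 3 5*g 4 5 +
      g 0 1*g 0 3*g 1 3*g 2 4*g 2 5*g 4 5 +
      g 0 1*g 0 4*g 1 4*g 2 3*g 2 5*g 3 5 +
      g 0 1*g 0 5*g 1 5*g 2 3*g 2 4*g 3 4 +
      g 0 2*g 0 3*g 2 3*g 1 4*g 1 5*g 4 5 +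
      g 0 2*g 0 4*g 2 4*g 1 3*g 1 5*g 3 5 +
      g 0 2*g 0 5*g 2 5*g 1 3*g 1 4*g 3 4 +
      g 0 3*g 0 4*g 3 4*g 1 2*g 1 5*g 2 5 +
      g 0 3*g 0 5*g 3 5*g 1 2*g 1 4*g 2 4 +
      g 0 4*g 0 5*g 4 5*g 1 2*g 1 3*g 2 3

/-- Explicit 60-term sum over matched pairs of triangles. -/
def eC {k : Type*} [CommRing k] (g : Fin 6 → Fin 6 → k) : k :=
      g 0 1*g 0 2*g 1 2*g 3 4*g 3 5*g 4 5*(g 0 3*g 1 4*g 2 5 + g 0 3*g 1 5*g 2 4 + g 0 4*g 1 3*g 2 5 + g 0 4*g 1 5*g 2 3 + g 0 5*g 1 3*g 2 4 + g 0 5*g 1 4*g 2 3) +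
      g 0 1*g 0 3*g 1 3*g 2 4*g 2 5*g 4 5*(g 0 2*g 1 4*g 3 5 + g 0 2*g 1 5*g 3 4 + g 0 4*g 1 2*g 3 5 + g 0 4*g 1 5*g 2 3 + g 0 5*g 1 2*g 3 4 + g 0 5*g 1 4*g 2 3) +
      g 0 1*g 0 4*g 1 4*g 2 3*g 2 5*g 3 5*(g 0 2*g 1 3*g 4 5 + g 0 2*g 1 5*g 3 4 + g 0 3*g 1 2*g 4 5 + g 0 3*g 1 5*g 2 4 + g 0 5*g 1 2*g 3 4 + g 0 5*g 1 3*g 2 4) +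
      g 0 1*g 0 5*g 1 5*g 2 3*g 2 4*g 3 4*(g 0 2*g 1 3*g 4 5 + g 0 2*g 1 4*g 3 5 + g 0 3*g 1 2*g 4 5 + g 0 3*g 1 4*g 2 5 + g 0 4*g 1 2*g 3 5 + g 0 4*g 1 3*g 2 5) +
      g 0 2*g 0 3*g 2 3*g 1 4*g 1 5*g 4 5*(g 0 1*g 2 4*g 3 5 + g 0 1*g 2 5*g 3 4 + g 0 4*g 1 2*g 3 5 + g 0 4*g 2 5*g 1 3 + g 0 5*g 1 2*g 3 4 + g 0 5*g 2 4*g 1 3) +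
      g 0 2*g 0 4*g 2 4*g 1 3*g 1 5*g 3 5*(g 0 1*g 2 3*g 4 5 + g 0 1*g 2 5*g 3 4 + g 0 3*g 1 2*g 4 5 + g 0 3*g 2 5*g 1 4 + g 0 5*g 1 2*g 3 4 + g 0 5*g 2 3*g 1 4) +
      g 0 2*g 0 5*g 2 5*g 1 3*g 1 4*g 3 4*(g 0 1*g 2 3*g 4 5 + g 0 1*g 2 4*g 3 5 + g 0 3*g 1 2*g 4 5 + g 0 3*g 2 4*g 1 5 + g 0 4*g 1 2*g 3 5 + g 0 4*g 2 3*g 1 5) +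
      g 0 3*g 0 4*g 3 4*g 1 2*g 1 5*g 2 5*(g 0 1*g 2 3*g 4 5 + g 0 1*g 3 5*g 2 4 + g 0 2*g 1 3*g 4 5 + g 0 2*g 3 5*g 1 4 + g 0 5*g 1 3*g 2 4 + g 0 5*g 2 3*g 1 4) +
      g 0 3*g 0 5*g 3 5*g 1 2*g 1 4*g 2 4*(g 0 1*g 2 3*g 4 5 + g 0 1*g 3 4*g 2 5 + g 0 2*g 1 3*g 4 5 + g 0 2*g 3 4*g 1 5 + g 0 4*g 1 3*g 2 5 + g 0 4*g 2 3*g 1 5) +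
      g 0 4*g 0 5*g 4 5*g 1 2*g 1 3*g 2 3*(g 0 1*g 2 4*g 3 5 + g 0 1*g 3 4*g 2 5 + g 0 2*g 1 4*g 3 5 + g 0 2*g 3 4*g 1 5 + g 0 3*g 1 4*g 2 5 + g 0 3*g 2 4*g 1 5)

lemma perm_sum4_pairs {k : Type*} [CommRing k] (g : Fin 4 → Fin 4 → k) (hs : ∀ i j, g i j = g j i) :
    ∑ σ : Equiv.Perm (Fin 4), g (σ 0) (σ 1) * g (σ 2) (σ 3) =
      8 * (g 0 1 * g 2 3 + g 0 2 * g 1 3 + g 0 3 * g 1 2) := by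
  rw [perm_sum4 (fun a b c d => g a b * g c d)]
  have h := fun p : Fin 4 => perm_sum3' (fun a b c =>
    g p (p.succAbove a) * g (p.succAbove b) (p.succAbove c))
  simp only [h, Fin.sum_univ_four]
  simp [Fin.succAbove]
  rw [hs 1 0, hs 2 0, hs 3 0, hs 2 1, hs 3 1, hs 3 2]
  ring

lemma sum_pairs {k : Type*} [CommRing k] (g : Fin 6 → Fin 6 → k) (hs : ∀ i j, g i j = g j i) :
    ∑ σ : Equiv.Perm (Fin 6), g (σ 0) (σ 1) * g (σ 2) (σ 3) * g (σ 4) (σ 5) =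
      48 * eA g := by
  rw [perm_sum6 (fun a b c d e f => g a b * g c d * g e f)]
  unfold eA
  have h5 := fun p : Fin 6 => perm_sum5 (fun b c d e f =>
    g p (p.succAbove b) * g (p.succAbove c) (p.succAbove d) * g (p.succAbove e) (p.succAbove f))
  simp only [h5]
  have h4 := fun (p : Fin 6) (q : Fin 5) => perm_sum4_pairs
    (fun c d => g (p.succAbove (q.succAbove c)) (p.succAbove (q.succAbove d))) (fun _ _ => hs _ _)
  simp only [mul_assoc, ← Finset.mul_sum, h4, Fin.sum_univ_six, Fin.sum_univ_five]
  simp [Fin.succAbove]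
  rw [hs 1 0,  hs 2 0,  hs 3 0,  hs 4 0,  hs 5 0,  hs 2 1,  hs 3 1,  hs 4 1,  hs 5 1,  hs 3 2,  hs 4 2,  hs 5 2,  hs 4 3,  hs 5 3,  hs 5 4]
  ring

lemma perm_sum3_tri {k : Type*} [CommRing k] (g : Fin 3 → Fin 3 → k) (hs : ∀ i j, g i j = g j i) :
    ∑ σ : Equiv.Perm (Fin 3), g (σ 0) (σ 1) * g (σ 1) (σ 2) * g (σ 2) (σ 0) =
      6 * (g 0 1 * g 0 2 * g 1 2) := by
  rw [perm_sum3' (fun a b c => g a b * g b c * g c a)]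
  rw [hs 1 0, hs 2 0, hs 2 1]
  ring

lemma sum_tri {k : Type*} [CommRing k] (g : Fin 6 → Fin 6 → k) (hs : ∀ i j, g i j = g j i) :
    ∑ σ : Equiv.Perm (Fin 6), (g (σ 0) (σ 1) * g (σ 1) (σ 2) * g (σ 2) (σ 0)) *
        (g (σ 3) (σ 4) * g (σ 4) (σ 5) * g (σ 5) (σ 3)) =
      72 * eB g := by
  rw [perm_sum6 (fun a b c d e f => (g a b * g b c * g c a) * (g d e * g e f * g f d))]
  unfold eB
  have h5 := fun p : Fin 6 => perm_sum5 (fun b c d e f =>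
    (g p (p.succAbove b) * g (p.succAbove b) (p.succAbove c) * g (p.succAbove c) p) *
     (g (p.succAbove d) (p.succAbove e) * g (p.succAbove e) (p.succAbove f) *
      g (p.succAbove f) (p.succAbove d)))
  simp only [h5]
  have h4 := fun (p : Fin 6) (q : Fin 5) => perm_sum4 (fun c d e f =>
    (g p (p.succAbove q) * g (p.succAbove q) (p.succAbove (q.succAbove c)) *
      g (p.succAbove (q.succAbove c)) p) *
     (g (p.succAbove (q.succAbove d)) (p.succAbove (q.succAbove e)) *
      g (p.succAbove (q.succAbove e)) (p.succAbove (q.succAbove f)) *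
      g (p.succAbove (q.succAbove f)) (p.succAbove (q.succAbove d))))
  simp only [h4]
  have h3 := fun (p : Fin 6) (q : Fin 5) (r : Fin 4) => perm_sum3_tri
    (fun c d => g (p.succAbove (q.succAbove (r.succAbove c)))
      (p.succAbove (q.succAbove (r.succAbove d)))) (fun _ _ => hs _ _)
  simp only [← Finset.mul_sum, h3, Fin.sum_univ_six, Fin.sum_univ_five, Fin.sum_univ_four]
  simp [Fin.succAbove]
  rw [hs 1 0,  hs 2 0,  hs 3 0,  hs 4 0,  hs 5 0,  hs 2 1,  hs 3 1,  hs 4 1,  hs 5 1,  hs 3 2,  hs 4 2,  hs 5 2,  hs 4 3,  hs 5 3,  hs 5 4]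
  ring

lemma perm_sum3_tri' {k : Type*} [CommRing k] (g : Fin 3 → Fin 3 → k) (hs : ∀ i j, g i j = g j i)
    (u v w : Fin 3 → k) :
    ∑ σ : Equiv.Perm (Fin 3), (g (σ 0) (σ 1) * g (σ 1) (σ 2) * g (σ 2) (σ 0)) *
        (u (σ 0) * v (σ 1) * w (σ 2)) =
      (g 0 1 * g 0 2 * g 1 2) * (u 0 * v 1 * w 2 + u 0 * v 2 * w 1 + u 1 * v 0 * w 2 +
        u 1 * v 2 * w 0 + u 2 * v 0 * w 1 + u 2 * v 1 * w 0) := by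
  rw [perm_sum3' (fun a b c => (g a b * g b c * g c a) * (u a * v b * w c))]
  rw [hs 1 0, hs 2 0, hs 2 1]
  ring

lemma sum_matched {k : Type*} [CommRing k] (g : Fin 6 → Fin 6 → k) (hs : ∀ i j, g i j = g j i) :
    ∑ σ : Equiv.Perm (Fin 6), (g (σ 0) (σ 1) * g (σ 1) (σ 2) * g (σ 2) (σ 0)) *
        (g (σ 3) (σ 4) * g (σ 4) (σ 5) * g (σ 5) (σ 3)) *
        (g (σ 0) (σ 3) * g (σ 1) (σ 4) * g (σ 2) (σ 5)) =
      12 * eC g := by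
  rw [perm_sum6 (fun a b c d e f => (g a b * g b c * g c a) * (g d e * g e f * g f d) *
    (g a d * g b e * g c f))]
  unfold eC
  have h5 := fun p : Fin 6 => perm_sum5 (fun b c d e f =>
    (g p (p.succAbove b) * g (p.succAbove b) (p.succAbove c) * g (p.succAbove c) p) *
     (g (p.succAbove d) (p.succAbove e) * g (p.succAbove e) (p.succAbove f) *
      g (p.succAbove f) (p.succAbove d)) *
     (g p (p.succAbove d) * g (p.succAbove b) (p.succAbove e) * g (p.succAbove c) (p.succAbove f)))
  simp only [h5]
  have h4 := fun (p : Fin 6) (q : Fin 5) => perm_sum4 (fun c d e f =>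
    (g p (p.succAbove q) * g (p.succAbove q) (p.succAbove (q.succAbove c)) *
      g (p.succAbove (q.succAbove c)) p) *
     (g (p.succAbove (q.succAbove d)) (p.succAbove (q.succAbove e)) *
      g (p.succAbove (q.succAbove e)) (p.succAbove (q.succAbove f)) *
      g (p.succAbove (q.succAbove f)) (p.succAbove (q.succAbove d))) *
     (g p (p.succAbove (q.succAbove d)) * g (p.succAbove q) (p.succAbove (q.succAbove e)) *
      g (p.succAbove (q.succAbove c)) (p.succAbove (q.succAbove f))))
  simp only [h4]
  have h3 := fun (p : Fin 6) (q : Fin 5) (r : Fin 4) => perm_sum3_tri'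
    (fun c d => g (p.succAbove (q.succAbove (r.succAbove c)))
      (p.succAbove (q.succAbove (r.succAbove d)))) (fun _ _ => hs _ _)
    (fun d => g p (p.succAbove (q.succAbove (r.succAbove d))))
    (fun d => g (p.succAbove q) (p.succAbove (q.succAbove (r.succAbove d))))
    (fun d => g (p.succAbove (q.succAbove r)) (p.succAbove (q.succAbove (r.succAbove d))))
  have ha : ∀ s t u : k, s * t * u = s * (t * u) := mul_assoc
  have ha' : ∀ (p : Fin 6) (q : Fin 5) (r : Fin 4) (t u : k),
    (g p (p.succAbove q) * g (p.succAbove q) (p.succAbove (q.succAbove r)) *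
      g (p.succAbove (q.succAbove r)) p) * t * u =
    (g p (p.succAbove q) * g (p.succAbove q) (p.succAbove (q.succAbove r)) *
      g (p.succAbove (q.succAbove r)) p) * (t * u) := fun _ _ _ _ _ => mul_assoc _ _ _
  simp only [ha', ← Finset.mul_sum, h3, Fin.sum_univ_six, Fin.sum_univ_five, Fin.sum_univ_four]
  simp [Fin.succAbove]
  rw [hs 1 0,  hs 2 0,  hs 3 0,  hs 4 0,  hs 5 0,  hs 2 1,  hs 3 1,  hs 4 1,  hs 5 1,  hs 3 2,  hs 4 2,  hs 5 2,  hs 4 3,  hs 5 3,  hs 5 4]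
  ring

/-- Joubert's six irrational invariants of six points, through the brackets `d i j`. -/
def Jb {k : Type*} [CommRing k] (d : Fin 6 → Fin 6 → k) : Fin 6 → k :=
  ![d 0 1 * d 2 3 * d 4 5 + d 0 2 * d 1 4 * d 3 5 + d 0 3 * d 1 5 * d 2 4 + d 0 4 * d 1 3 * d 2 5 + d 0 5 * d 1 2 * d 3 4,
    d 0 1 * d 2 3 * d 4 5 - d 0 2 * d 1 5 * d 3 4 - d 0 3 * d 1 4 * d 2 5 - d 0 4 * d 1 2 * d 3 5 - d 0 5 * d 1 3 * d 2 4,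
    -d 0 1 * d 2 4 * d 3 5 - d 0 2 * d 1 3 * d 4 5 - d 0 3 * d 1 4 * d 2 5 - d 0 4 * d 1 5 * d 2 3 + d 0 5 * d 1 2 * d 3 4,
    -d 0 1 * d 2 4 * d 3 5 - d 0 2 * d 1 5 * d 3 4 + d 0 3 * d 1 2 * d 4 5 + d 0 4 * d 1 3 * d 2 5 + d 0 5 * d 1 4 * d 2 3,
    d 0 1 * d 2 5 * d 3 4 - d 0 2 * d 1 3 * d 4 5 + d 0 3 * d 1 5 * d 2 4 - d 0 4 * d 1 2 * d 3 5 + d 0 5 * d 1 4 * d 2 3,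
    d 0 1 * d 2 5 * d 3 4 + d 0 2 * d 1 4 * d 3 5 + d 0 3 * d 1 2 * d 4 5 - d 0 4 * d 1 5 * d 2 3 - d 0 5 * d 1 3 * d 2 4]

/-- The explicit discriminant root. -/
def eD {k : Type*} [CommRing k] (d : Fin 6 → Fin 6 → k) : k :=
  d 0 1 * d 0 2 * d 0 3 * d 0 4 * d 0 5 * d 1 2 * d 1 3 * d 1 4 * d 1 5 * d 2 3 * d 2 4 * d 2 5 *
    d 3 4 * d 3 5 * d 4 5

/-- The statement that the polynomial with roots `J i` has the given coefficients. -/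
def SexticId {k : Type*} [CommRing k] (J : Fin 6 → k) (A B C D : k) : Prop :=
  ∀ T : k, 27 * ((T - J 0) * (T - J 1) * (T - J 2) * (T - J 3) * (T - J 4) * (T - J 5)) =
    27 * T ^ 6 - 54 * A * T ^ 4 + (36 * A ^ 2 - 576 * B) * T ^ 2 - 27648 * D * T +
      (- 8 * A ^ 3 - 640 * A * B + 3072 * C)

lemma sexticId_norm {k : Type*} [CommRing k] (d : Fin 6 → Fin 6 → k) (a b c : k)
    (h01 : d 0 1 = -1) (h02 : d 0 2 = -1) (h03 : d 0 3 = -a) (h04 : d 0 4 = -b) (h05 : d 0 5 = -c)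
    (h12 : d 1 2 = -1) (h13 : d 1 3 = 1 - a) (h14 : d 1 4 = 1 - b) (h15 : d 1 5 = 1 - c)
    (h23 : d 2 3 = 1) (h24 : d 2 4 = 1) (h25 : d 2 5 = 1)
    (h34 : d 3 4 = a - b) (h35 : d 3 5 = a - c) (h45 : d 4 5 = b - c) :
    SexticId (Jb d) (eA fun i j => d i j ^ 2) (eB fun i j => d i j ^ 2) (eC fun i j => d i j ^ 2)
      (eD d) := by
  intro T
  simp only [eA, eB, eC, eD, h01, h02, h03, h04, h05, h12, h13, h14, h15, h23, h24, h25, h34, h35,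
    h45]
  have j0 : Jb d 0 = 2 * c - 2 * b - 2 * b * c - 2 * a + 2 * a * c + 2 * a * b := by
    simp [Jb, h01, h02, h03, h04, h05, h12, h13, h14, h15, h23, h24, h25, h34, h35, h45]
    ring
  have j1 : Jb d 1 = 2 * c - 2 * b + 2 * b * c + 2 * a - 2 * a * c - 2 * a * b := by
    simp [Jb, h01, h02, h03, h04, h05, h12, h13, h14, h15, h23, h24, h25, h34, h35, h45]
    ring
  have j2 : Jb d 2 = -2 * c + 2 * b - 2 * b * c + 2 * a + 2 * a * c - 2 * a * b := by
    simp [Jb, h01, h02, h03, h04, h05, h12, h13, h14, h15, h23, h24, h25, h34, h35, h45]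
    ring
  have j3 : Jb d 3 = -2 * c - 2 * b + 2 * b * c + 2 * a - 2 * a * c + 2 * a * b := by
    simp [Jb, h01, h02, h03, h04, h05, h12, h13, h14, h15, h23, h24, h25, h34, h35, h45]
    ring
  have j4 : Jb d 4 = -2 * c + 2 * b + 2 * b * c - 2 * a + 2 * a * c - 2 * a * b := by
    simp [Jb, h01, h02, h03, h04, h05, h12, h13, h14, h15, h23, h24, h25, h34, h35, h45]
    ring
  have j5 : Jb d 5 = 2 * c + 2 * b - 2 * b * c - 2 * a - 2 * a * c + 2 * a * b := by
    simp [Jb, h01, h02, h03, h04, h05, h12, h13, h14, h15, h23, h24, h25, h34, h35, h45]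
    ring
  rw [j0, j1, j2, j3, j4, j5]
  ring

lemma sexticId_scale {k : Type*} [CommRing k] (d d' : Fin 6 → Fin 6 → k) (μ : k) (l : Fin 6 → k)
    (h : ∀ i j, d i j = μ * l i * l j * d' i j) :
    ∃ s : k, s = μ ^ 3 * (l 0 * l 1 * l 2 * l 3 * l 4 * l 5) ∧
      (∀ i, Jb d i = s * Jb d' i) ∧
      (eA fun i j => d i j ^ 2) = s ^ 2 * (eA fun i j => d' i j ^ 2) ∧
      (eB fun i j => d i j ^ 2) = s ^ 4 * (eB fun i j => d' i j ^ 2) ∧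
      (eC fun i j => d i j ^ 2) = s ^ 6 * (eC fun i j => d' i j ^ 2) ∧
      (eD d) = s ^ 5 * eD d' := by
  refine ⟨_, rfl, ?_, ?_, ?_, ?_, ?_⟩
  · intro i
    fin_cases i <;> simp [Jb, h] <;> ring
  · simp only [eA, h]; ring
  · simp only [eB, h]; ring
  · simp only [eC, h]; ring
  · simp only [eD, h]; ring

lemma Dij_ne {k : Type*} [Field k] {x y : Fin 6 → k} (h : I10r x y ≠ 0) (i j : Fin 6)
    (hij : i ≠ j) : Dij x y i j ≠ 0 := by
  rw [I10r, Finset.prod_ne_zero_iff] at h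
  rcases lt_or_gt_of_ne hij with hl | hl
  · have := h (i, j) (by simpa using hl)
    simpa using this
  · have := h (j, i) (by simpa using hl)
    intro h0
    apply this
    have : Dij x y j i = - Dij x y i j := by simp only [Dij]; ring
    simp [this, h0]

lemma I10r_eq {k : Type*} [Field k] (x y : Fin 6 → k) : I10r x y = eD (Dij x y) ^ 2 := by
  rw [I10r, Finset.prod_filter, Fintype.prod_prod_type]
  simp [Fin.prod_univ_succ, eD]
  ring

lemma exists_norm {k : Type*} [Field k] (x y : Fin 6 → k) (h : I10r x y ≠ 0) :
    ∃ (μ : k) (l : Fin 6 → k) (a b c : k), (∀ i, l i ≠ 0) ∧ μ ≠ 0 ∧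
      ∀ i j, Dij x y i j = μ * l i * l j *
        Dij ![0, 1, 1, a, b, c] ![1, 1, 0, 1, 1, 1] i j := by
  have hD := Dij_ne h
  have h01 := hD 0 1 (by decide)
  have h20 := hD 2 0 (by decide)
  have h21 := hD 2 1 (by decide)
  have h23 := hD 2 3 (by decide)
  have h24 := hD 2 4 (by decide)
  have h25 := hD 2 5 (by decide)
  refine ⟨- Dij x y 0 1 / (Dij x y 2 0 * Dij x y 2 1),
    ![Dij x y 2 0, Dij x y 2 1, - (Dij x y 2 0 * Dij x y 2 1) / Dij x y 0 1,
      Dij x y 2 3, Dij x y 2 4, Dij x y 2 5],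
    Dij x y 0 3 * Dij x y 2 1 / (Dij x y 0 1 * Dij x y 2 3),
    Dij x y 0 4 * Dij x y 2 1 / (Dij x y 0 1 * Dij x y 2 4),
    Dij x y 0 5 * Dij x y 2 1 / (Dij x y 0 1 * Dij x y 2 5), ?_, ?_, ?_⟩
  · intro i
    fin_cases i <;> simp [h01, h20, h21, h23, h24, h25]
  · simp [h01, h20, h21]
  · obtain ⟨E, hE⟩ : ∃ E : Fin 6 → Fin 6 → k, E = Dij x y := ⟨_, rfl⟩
    rw [← hE] at h01 h20 h21 h23 h24 h25 ⊢
    have hE' : ∀ i j, E i j = x i * y j - x j * y i := by intro i j; rw [hE, Dij]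
    clear hE hD
    intro i j
    fin_cases i <;> fin_cases j <;> simp [Dij] <;> (try field_simp) <;> simp only [hE'] <;> ring

lemma sumPairs_eq {k : Type*} [Field k] (h2 : (2 : k) ≠ 0) (h3 : (3 : k) ≠ 0) (x y : Fin 6 → k) :
    sumPairs x y = eA fun i j => Dij x y i j ^ 2 := by
  have h48 : (48 : k) ≠ 0 := by
    have : (48 : k) = 2 ^ 4 * 3 := by norm_num
    rw [this]; exact mul_ne_zero (pow_ne_zero _ h2) h3
  rw [sumPairs, sum_pairs (fun i j => Dij x y i j ^ 2) (by intro i j; simp only [Dij]; ring),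
    ← mul_assoc, inv_mul_cancel₀ h48, one_mul]

lemma sumB_eq {k : Type*} [Field k] (h2 : (2 : k) ≠ 0) (h3 : (3 : k) ≠ 0) (x y : Fin 6 → k) :
    sumB x y = eB fun i j => Dij x y i j ^ 2 := by
  have h48 : (72 : k) ≠ 0 := by
    have : (72 : k) = 2 ^ 3 * 3 ^ 2 := by norm_num
    rw [this]; exact mul_ne_zero (pow_ne_zero _ h2) (pow_ne_zero _ h3)
  rw [sumB, sum_tri (fun i j => Dij x y i j ^ 2) (by intro i j; simp only [Dij]; ring),
    ← mul_assoc, inv_mul_cancel₀ h48, one_mul]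

lemma sumC_eq {k : Type*} [Field k] (h2 : (2 : k) ≠ 0) (h3 : (3 : k) ≠ 0) (x y : Fin 6 → k) :
    sumC x y = eC fun i j => Dij x y i j ^ 2 := by
  have h48 : (12 : k) ≠ 0 := by
    have : (12 : k) = 2 ^ 2 * 3 := by norm_num
    rw [this]; exact mul_ne_zero (pow_ne_zero _ h2) h3
  rw [sumC, sum_matched (fun i j => Dij x y i j ^ 2) (by intro i j; simp only [Dij]; ring),
    ← mul_assoc, inv_mul_cancel₀ h48, one_mul]

lemma sexticId_main {k : Type*} [Field k] (h2 : (2 : k) ≠ 0) (h3 : (3 : k) ≠ 0) (x y : Fin 6 → k)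
    (h : I10r x y ≠ 0) :
    SexticId (Jb (Dij x y)) (sumPairs x y) (sumB x y) (sumC x y) (eD (Dij x y)) := by
  rw [sumPairs_eq h2 h3, sumB_eq h2 h3, sumC_eq h2 h3]
  obtain ⟨μ, l, a, b, c, hl, hμ, hD⟩ := exists_norm x y h
  obtain ⟨s, hs, hJ, hA, hB, hC, hDD⟩ := sexticId_scale _ _ μ l hD
  have hs0 : s ≠ 0 := by
    rw [hs]; simp [hl, hμ]
  rw [hA, hB, hC, hDD]
  have H := sexticId_norm (Dij ![0, 1, 1, a, b, c] ![1, 1, 0, 1, 1, 1]) a b c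
    (by simp [Dij]) (by simp [Dij]) (by simp [Dij]) (by simp [Dij]) (by simp [Dij]) (by simp [Dij])
    (by simp [Dij]) (by simp [Dij]) (by simp [Dij]) (by simp [Dij]) (by simp [Dij]) (by simp [Dij])
    (by simp [Dij]) (by simp [Dij]) (by simp [Dij])
  intro T
  obtain ⟨U, rfl⟩ : ∃ U, T = s * U := ⟨T / s, by field_simp⟩
  have := H U
  simp only [hJ]
  linear_combination s ^ 6 * this

/-- `τ` is induced on Joubert's invariants by a permutation of the six points, up to sign. -/
def JPerm (k : Type*) [Field k] (τ : Equiv.Perm (Fin 6)) : Prop :=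
  ∃ (σ : Equiv.Perm (Fin 6)) (ε : k), (ε = 1 ∨ ε = -1) ∧
    ∀ (x y : Fin 6 → k) (i : Fin 6), Jb (Dij (x ∘ σ) (y ∘ σ)) i = ε * Jb (Dij x y) (τ i)

lemma JPerm_of {k : Type*} [Field k] (τ σ : Equiv.Perm (Fin 6)) (t s : Fin 6 → Fin 6)
    (ht : ∀ i, τ i = t i) (hs : ∀ i, σ i = s i)
    (h : ∀ (x y : Fin 6 → k) (i : Fin 6), Jb (Dij (x ∘ s) (y ∘ s)) i = - Jb (Dij x y) (t i)) :
    JPerm k τ := by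
  refine ⟨σ, -1, Or.inr rfl, fun x y i => ?_⟩
  have : (σ : Fin 6 → Fin 6) = s := funext hs
  rw [this, h, ht]; ring

lemma JPerm_swap (k : Type*) [Field k] (i : Fin 5) :
    JPerm k (Equiv.swap i.castSucc i.succ) := by
  fin_cases i
  · refine JPerm_of _ (Equiv.swap 0 1 * Equiv.swap 2 3 * Equiv.swap 4 5) ![1, 0, 2, 3, 4, 5]
      ![1, 0, 3, 2, 5, 4] (by decide) (by decide) (fun x y i => ?_)
    fin_cases i <;> simp [Jb, Dij] <;> ring
  · refine JPerm_of _ (Equiv.swap 0 3 * Equiv.swap 1 4 * Equiv.swap 2 5) ![0, 2, 1, 3, 4, 5]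
      ![3, 4, 5, 0, 1, 2] (by decide) (by decide) (fun x y i => ?_)
    fin_cases i <;> simp [Jb, Dij] <;> ring
  · refine JPerm_of _ (Equiv.swap 0 1 * Equiv.swap 2 4 * Equiv.swap 3 5) ![0, 1, 3, 2, 4, 5]
      ![1, 0, 4, 5, 2, 3] (by decide) (by decide) (fun x y i => ?_)
    fin_cases i <;> simp [Jb, Dij] <;> ring
  · refine JPerm_of _ (Equiv.swap 0 5 * Equiv.swap 1 4 * Equiv.swap 2 3) ![0, 1, 2, 4, 3, 5]
      ![5, 4, 3, 2, 1, 0] (by decide) (by decide) (fun x y i => ?_)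
    fin_cases i <;> simp [Jb, Dij] <;> ring
  · refine JPerm_of _ (Equiv.swap 0 1 * Equiv.swap 2 5 * Equiv.swap 3 4) ![0, 1, 2, 3, 5, 4]
      ![1, 0, 5, 4, 3, 2] (by decide) (by decide) (fun x y i => ?_)
    fin_cases i <;> simp [Jb, Dij] <;> ring

lemma JPerm_all (k : Type*) [Field k] (τ : Equiv.Perm (Fin 6)) : JPerm k τ := by
  have hτ : τ ∈ Submonoid.closure
      (Set.range fun i : Fin 5 => Equiv.swap i.castSucc i.succ) := by
    rw [Equiv.Perm.mclosure_swap_castSucc_succ]; trivial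
  induction hτ using Submonoid.closure_induction with
  | mem τ h => obtain ⟨i, rfl⟩ := h; exact JPerm_swap k i
  | one => exact ⟨1, 1, Or.inl rfl, fun x y i => by simp⟩
  | mul τ₁ τ₂ _ _ h₁ h₂ =>
    obtain ⟨σ₁, ε₁, he₁, h₁⟩ := h₁
    obtain ⟨σ₂, ε₂, he₂, h₂⟩ := h₂
    refine ⟨σ₁ * σ₂, ε₂ * ε₁, ?_, fun x y i => ?_⟩
    · rcases he₁ with rfl | rfl <;> rcases he₂ with rfl | rfl <;> simp
    · have := h₂ (x ∘ σ₁) (y ∘ σ₁) i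
      rw [h₁] at this
      rw [Equiv.Perm.coe_mul, ← Function.comp_assoc, ← Function.comp_assoc, this,
        Equiv.Perm.mul_apply, mul_assoc]

/-- Equal polynomial functions with split roots have the same roots up to order. -/
lemma exists_perm_of_prod {k : Type*} [Field k] [Infinite k] (u v : Fin 6 → k)
    (h : ∀ T : k, (T - u 0) * (T - u 1) * (T - u 2) * (T - u 3) * (T - u 4) * (T - u 5) =
      (T - v 0) * (T - v 1) * (T - v 2) * (T - v 3) * (T - v 4) * (T - v 5)) :
    ∃ τ : Equiv.Perm (Fin 6), ∀ i, u i = v (τ i) := by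
  have hp : (∏ i, (Polynomial.X - Polynomial.C (u i))) =
      ∏ i, (Polynomial.X - Polynomial.C (v i)) := by
    apply Polynomial.funext
    intro T
    simp only [Fin.prod_univ_six, Polynomial.eval_mul, Polynomial.eval_sub, Polynomial.eval_X,
      Polynomial.eval_C]
    exact h T
  have hroots : ∀ w : Fin 6 → k, (∏ i, (Polynomial.X - Polynomial.C (w i))).roots =
      (Finset.univ : Finset (Fin 6)).val.map w := by
    intro w
    have := Polynomial.roots_multiset_prod_X_sub_C ((Finset.univ : Finset (Fin 6)).val.map w)
    rw [Multiset.map_map] at this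
    exact this
  have hr := congrArg Polynomial.roots hp
  rw [hroots, hroots] at hr
  have hc : ∀ c : k, Nonempty ({i // u i = c} ≃ {i // v i = c}) := by
    intro c
    refine ⟨Fintype.equivOfCardEq ?_⟩
    have h1 := congrArg (Multiset.count c) hr
    rw [Multiset.count_map, Multiset.count_map] at h1
    rw [Fintype.card_subtype, Fintype.card_subtype]
    simp only [eq_comm (a := c)] at h1
    exact h1
  have e : ∀ c, {i // u i = c} ≃ {i // v i = c} := fun c => Classical.choice (hc c)
  let τ : Equiv.Perm (Fin 6) :=
    ((Equiv.sigmaFiberEquiv u).symm.trans (Equiv.sigmaCongrRight e)).trans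
      (Equiv.sigmaFiberEquiv v)
  refine ⟨τ, fun i => ?_⟩
  exact ((e (u i)) ⟨i, rfl⟩).2.symm

lemma proj_equiv {k : Type*} [Field k] [IsAlgClosed k] (h2 : (2 : k) ≠ 0) (x y x' y' : Fin 6 → k)
    (h : I10r x y ≠ 0) (h' : I10r x' y' ≠ 0) (ρ : k)
    (hJ : ∀ i, Jb (Dij x y) i = ρ * Jb (Dij x' y') i) :
    ∃ (p q r s : k) (l : Fin 6 → k), p * s - q * r ≠ 0 ∧ ∏ i, l i = 1 ∧
      ∀ i, p * x i + q * y i = l i * x' i ∧ r * x i + s * y i = l i * y' i := by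
  have hD := Dij_ne h
  have hD' := Dij_ne h'
  have h4 : (4 : k) ≠ 0 := by
    have : (4 : k) = 2 ^ 2 := by norm_num
    rw [this]; exact pow_ne_zero _ h2
  have b : ∀ u v : Fin 6 → k,
      4 * (Dij u v 1 2 * Dij u v 0 3 * Dij u v 4 5) = Jb (Dij u v) 3 + Jb (Dij u v) 5 ∧
      -4 * (Dij u v 0 2 * Dij u v 1 3 * Dij u v 4 5) = Jb (Dij u v) 2 + Jb (Dij u v) 4 ∧
      -4 * (Dij u v 1 2 * Dij u v 0 4 * Dij u v 3 5) = Jb (Dij u v) 1 + Jb (Dij u v) 4 ∧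
      4 * (Dij u v 0 2 * Dij u v 1 4 * Dij u v 3 5) = Jb (Dij u v) 0 + Jb (Dij u v) 5 ∧
      4 * (Dij u v 1 2 * Dij u v 0 5 * Dij u v 3 4) = Jb (Dij u v) 0 + Jb (Dij u v) 2 ∧
      -4 * (Dij u v 0 2 * Dij u v 1 5 * Dij u v 3 4) = Jb (Dij u v) 1 + Jb (Dij u v) 3 := by
    intro u v
    refine ⟨?_, ?_, ?_, ?_, ?_, ?_⟩ <;> simp [Jb, Dij] <;> ring
  obtain ⟨a1, a2, a3, a4, a5, a6⟩ := b x y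
  obtain ⟨b1, b2, b3, b4, b5, b6⟩ := b x' y'
  simp only [hJ] at a1 a2 a3 a4 a5 a6
  have c3 : Dij x y 1 2 * Dij x y 0 3 * (Dij x' y' 0 2 * Dij x' y' 1 3) =
      Dij x y 0 2 * Dij x y 1 3 * (Dij x' y' 1 2 * Dij x' y' 0 3) := by
    apply mul_left_cancel₀ (mul_ne_zero (mul_ne_zero h4 h4) (mul_ne_zero (hD 4 5 (by decide)) (hD' 4 5 (by decide))))
    linear_combination 4 * Dij x' y' 0 2 * Dij x' y' 1 3 * Dij x' y' 4 5 * a1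
      - ρ * b1 * 4 * Dij x' y' 0 2 * Dij x' y' 1 3 * Dij x' y' 4 5
      + 4 * Dij x' y' 1 2 * Dij x' y' 0 3 * Dij x' y' 4 5 * a2
      - ρ * b2 * 4 * Dij x' y' 1 2 * Dij x' y' 0 3 * Dij x' y' 4 5
  have c4 : Dij x y 1 2 * Dij x y 0 4 * (Dij x' y' 0 2 * Dij x' y' 1 4) =
      Dij x y 0 2 * Dij x y 1 4 * (Dij x' y' 1 2 * Dij x' y' 0 4) := by
    apply mul_left_cancel₀ (mul_ne_zero (mul_ne_zero h4 h4) (mul_ne_zero (hD 3 5 (by decide)) (hD' 3 5 (by decide))))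
    linear_combination -4 * Dij x' y' 0 2 * Dij x' y' 1 4 * Dij x' y' 3 5 * a3
      + ρ * b3 * 4 * Dij x' y' 0 2 * Dij x' y' 1 4 * Dij x' y' 3 5
      - 4 * Dij x' y' 1 2 * Dij x' y' 0 4 * Dij x' y' 3 5 * a4
      + ρ * b4 * 4 * Dij x' y' 1 2 * Dij x' y' 0 4 * Dij x' y' 3 5
  have c5 : Dij x y 1 2 * Dij x y 0 5 * (Dij x' y' 0 2 * Dij x' y' 1 5) =
      Dij x y 0 2 * Dij x y 1 5 * (Dij x' y' 1 2 * Dij x' y' 0 5) := by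
    apply mul_left_cancel₀ (mul_ne_zero (mul_ne_zero h4 h4) (mul_ne_zero (hD 3 4 (by decide)) (hD' 3 4 (by decide))))
    linear_combination 4 * Dij x' y' 0 2 * Dij x' y' 1 5 * Dij x' y' 3 4 * a5
      - ρ * b5 * 4 * Dij x' y' 0 2 * Dij x' y' 1 5 * Dij x' y' 3 4
      + 4 * Dij x' y' 1 2 * Dij x' y' 0 5 * Dij x' y' 3 4 * a6
      - ρ * b6 * 4 * Dij x' y' 1 2 * Dij x' y' 0 5 * Dij x' y' 3 4
  obtain ⟨α, hα⟩ : ∃ α, α = Dij x' y' 2 1 * Dij x y 2 0 := ⟨_, rfl⟩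
  obtain ⟨β, hβ⟩ : ∃ β, β = - (Dij x' y' 2 0 * Dij x y 2 1) := ⟨_, rfl⟩
  obtain ⟨p, hp⟩ : ∃ p, p = α * x' 0 * y 1 + β * x' 1 * y 0 := ⟨_, rfl⟩
  obtain ⟨q, hq⟩ : ∃ q, q = -(α * x' 0 * x 1 + β * x' 1 * x 0) := ⟨_, rfl⟩
  obtain ⟨r, hr⟩ : ∃ r, r = α * y' 0 * y 1 + β * y' 1 * y 0 := ⟨_, rfl⟩
  obtain ⟨s, hs⟩ : ∃ s, s = -(α * y' 0 * x 1 + β * y' 1 * x 0) := ⟨_, rfl⟩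
  have hdet : p * s - q * r ≠ 0 := by
    have e : p * s - q * r = α * β * (Dij x' y' 0 1) * Dij x y 1 0 := by
      subst hp hq hr hs; simp only [Dij]; ring
    rw [e, hα, hβ]
    have e1 := hD 2 0 (by decide)
    have e2 := hD 2 1 (by decide)
    have e3 := hD 1 0 (by decide)
    have e4 := hD' 2 0 (by decide)
    have e5 := hD' 2 1 (by decide)
    have e6 := hD' 0 1 (by decide)
    simp [e1, e2, e3, e4, e5, e6]
  have hprop : ∀ i, (p * x i + q * y i) * y' i = (r * x i + s * y i) * x' i := by
    intro i
    subst hp hq hr hs hα hβ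
    fin_cases i
    · simp only [Dij]; simp; ring
    · simp only [Dij]; simp; ring
    · simp only [Dij]; simp; ring
    · simp only [Dij] at c3 ⊢; simp; linear_combination c3
    · simp only [Dij] at c4 ⊢; simp; linear_combination c4
    · simp only [Dij] at c5 ⊢; simp; linear_combination c5
  have hnz : ∀ i, x' i ≠ 0 ∨ y' i ≠ 0 := by
    intro i
    by_contra hcon
    push Not at hcon
    obtain ⟨j, hj⟩ := exists_ne i
    exact hD' i j hj.symm (by simp [Dij, hcon.1, hcon.2])
  have hl : ∀ i, ∃ l, p * x i + q * y i = l * x' i ∧ r * x i + s * y i = l * y' i := by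
    intro i
    rcases hnz i with hx | hy
    · refine ⟨(p * x i + q * y i) / x' i, by field_simp, ?_⟩
      field_simp
      linear_combination - hprop i
    · refine ⟨(r * x i + s * y i) / y' i, ?_, by field_simp⟩
      field_simp
      linear_combination hprop i
  choose l hl1 hl2 using hl
  have hl0 : ∀ i, l i ≠ 0 := by
    intro i h0
    obtain ⟨j, hj⟩ := exists_ne i
    have e : (p * s - q * r) * Dij x y i j = l i * l j * Dij x' y' i j := by
      have : (p * x i + q * y i) * (r * x j + s * y j) - (p * x j + q * y j) * (r * x i + s * y i) =
        (p * s - q * r) * Dij x y i j := by simp only [Dij]; ring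
      rw [← this, hl1, hl2, hl1, hl2]; simp only [Dij]; ring
    rw [h0] at e
    simp only [zero_mul] at e
    exact mul_ne_zero hdet (hD i j hj.symm) e
  obtain ⟨ν, hν⟩ := IsAlgClosed.exists_pow_nat_eq (∏ i, l i)⁻¹ (n := 6) (by norm_num)
  have hprod : ∏ i, l i ≠ 0 := Finset.prod_ne_zero_iff.2 fun i _ => hl0 i
  have hν0 : ν ≠ 0 := by
    rintro rfl
    rw [zero_pow (by norm_num)] at hν
    exact inv_ne_zero hprod hν.symm
  refine ⟨ν * p, ν * q, ν * r, ν * s, fun i => ν * l i, ?_, ?_, fun i => ⟨?_, ?_⟩⟩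
  · have : ν * p * (ν * s) - ν * q * (ν * r) = ν ^ 2 * (p * s - q * r) := by ring
    rw [this]
    exact mul_ne_zero (pow_ne_zero _ hν0) hdet
  · rw [Finset.prod_mul_distrib]
    simp only [Finset.prod_const, Finset.card_univ, Fintype.card_fin]
    rw [hν, inv_mul_cancel₀ hprod]
  · linear_combination ν * hl1 i
  · linear_combination ν * hl2 i
lemma toForm_formCoeff {k : Type*} [CommSemiring k] (d : ℕ) (p : MvPolynomial (Fin 2) k)
    (hp : p.IsHomogeneous d) : toForm k d (formCoeff k d p) = p := by
  have hm : ∀ (m : Fin 2 →₀ ℕ), Finsupp.single 0 (m 0) + Finsupp.single 1 (m 1) = m := by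
    intro m
    ext i
    fin_cases i <;> simp
  have hterm : ∀ i : Fin (d+1), (C (formCoeff k d p i) * X 0 ^ (d - (i : ℕ)) * X 1 ^ (i : ℕ) :
      MvPolynomial (Fin 2) k) =
      monomial (Finsupp.single 0 (d - (i : ℕ)) + Finsupp.single 1 (i : ℕ))
        (formCoeff k d p i) := by
    intro i
    rw [X_pow_eq_monomial, X_pow_eq_monomial, C_mul_monomial, monomial_mul]
    simp
  ext m
  unfold toForm
  simp only [hterm, coeff_sum, coeff_monomial]
  by_cases hd : m 0 + m 1 = d
  · have hlt : m 1 < d + 1 := by omega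
    have he : ∀ i : Fin (d+1),
        (Finsupp.single 0 (d - (i : ℕ)) + Finsupp.single 1 (i : ℕ) = m) ↔
          (⟨m 1, hlt⟩ : Fin (d+1)) = i := by
      intro i
      constructor
      · intro h
        have := DFunLike.congr_fun h 1
        simp at this
        ext
        exact this.symm
      · rintro rfl
        have : d - m 1 = m 0 := by omega
        simp only [this, hm]
    simp only [he, Finset.sum_ite_eq, Finset.mem_univ, if_true]
    unfold formCoeff
    have : d - m 1 = m 0 := by omega
    simp only [this, hm]
  · have h0 : coeff m p = 0 := by
      by_contra hne
      apply hd
      have h1 := hp hne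
      rw [Finsupp.weight_apply, Finsupp.sum_fintype _ _ (by simp)] at h1
      simpa using h1
    rw [h0]
    apply Finset.sum_eq_zero
    intro i _
    rw [if_neg]
    intro h
    apply hd
    have h1 := DFunLike.congr_fun h 1
    have h2 := DFunLike.congr_fun h 0
    simp at h1 h2
    omega

lemma formCoeff_eq {k : Type*} [Field k] (d : ℕ) (p : MvPolynomial (Fin 2) k)
    (hp : p.IsHomogeneous d) (j : Fin (d+1)) :
    formCoeff k d p j =
      (aeval (![1, Polynomial.X] : Fin 2 → Polynomial k) p).coeff (j : ℕ) := by
  conv_rhs => rw [← toForm_formCoeff d p hp]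
  unfold toForm
  simp only [map_sum, map_mul, map_pow, aeval_X, aeval_C, Polynomial.finsetSum_coeff]
  simp only [Matrix.cons_val_zero, Matrix.cons_val_one, one_pow, mul_one,
    Polynomial.algebraMap_eq, Polynomial.coeff_C_mul, Polynomial.coeff_X_pow]
  rw [Finset.sum_eq_single j]
  · simp
  · intro i _ hij
    rw [if_neg, mul_zero]
    intro h
    exact hij (Fin.ext h.symm)
  · simp

lemma sextic_homog {k : Type*} [Field k] (x y : Fin 6 → k) :
    (∏ i : Fin 6, (C (y i) * X 0 - C (x i) * X 1) : MvPolynomial (Fin 2) k).IsHomogeneous 6 := by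
  have := IsHomogeneous.prod (Finset.univ : Finset (Fin 6))
    (fun i => (C (y i) * X 0 - C (x i) * X 1 : MvPolynomial (Fin 2) k)) (fun _ => 1)
    (fun i _ => ((isHomogeneous_X k 0).C_mul (y i)).sub ((isHomogeneous_X k 1).C_mul (x i)))
  simpa using this

lemma factor_poly {k : Type*} [Field k] [IsAlgClosed k] (n : ℕ) :
    ∀ f : Polynomial k, f.natDegree ≤ n → ∃ (c : k) (x y : Fin n → k),
      f = Polynomial.C c * ∏ i, (Polynomial.C (y i) - Polynomial.C (x i) * Polynomial.X) := by
  induction n with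
  | zero =>
    intro f hf
    refine ⟨f.coeff 0, Fin.elim0, Fin.elim0, ?_⟩
    rw [Finset.univ_eq_empty, Finset.prod_empty, mul_one]
    exact Polynomial.eq_C_of_natDegree_le_zero hf
  | succ n ih =>
    intro f hf
    by_cases hn : f.natDegree ≤ n
    · obtain ⟨c, x, y, h⟩ := ih f hn
      refine ⟨c, Fin.cons 0 x, Fin.cons 1 y, ?_⟩
      rw [Fin.prod_univ_succ]
      simpa using h
    · have hdeg : f.degree ≠ 0 := by
        intro h0
        have h1 : f.natDegree = 0 := Polynomial.natDegree_eq_of_degree_eq_some h0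
        omega
      obtain ⟨t, ht⟩ := IsAlgClosed.exists_root f hdeg
      obtain ⟨q, hq⟩ := Polynomial.dvd_iff_isRoot.mpr ht
      have hq0 : q ≠ 0 := by
        rintro rfl
        rw [mul_zero] at hq
        rw [hq] at hn
        simp at hn
      have hqd : q.natDegree ≤ n := by
        have h1 := congrArg Polynomial.natDegree hq
        rw [Polynomial.natDegree_mul (Polynomial.X_sub_C_ne_zero t) hq0,
          Polynomial.natDegree_X_sub_C] at h1
        omega
      obtain ⟨c, x, y, h⟩ := ih q hqd
      refine ⟨c, Fin.cons (-1) x, Fin.cons (-t) y, ?_⟩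
      rw [Fin.prod_univ_succ]
      simp only [Fin.cons_zero, Fin.cons_succ]
      rw [hq]
      conv_lhs => rw [h]
      simp only [Polynomial.C_neg, Polynomial.C_1]
      ring

lemma exists_sextic {k : Type*} [Field k] [IsAlgClosed k] (a : Fin 7 → k) :
    ∃ x y : Fin 6 → k, sexticCoeff x y = a := by
  set f : Polynomial k := ∑ i : Fin 7, Polynomial.C (a i) * Polynomial.X ^ (i : ℕ) with hf
  have hfd : f.natDegree ≤ 6 := by
    rw [hf]
    apply Polynomial.natDegree_sum_le_of_forall_le
    intro i _
    refine (Polynomial.natDegree_C_mul_X_pow_le _ _).trans ?_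
    have := i.2
    omega
  obtain ⟨c, x, y, h⟩ := factor_poly 6 f hfd
  obtain ⟨μ, hμ⟩ := IsAlgClosed.exists_pow_nat_eq c (show 0 < 6 by norm_num)
  refine ⟨fun i => μ * x i, fun i => μ * y i, ?_⟩
  funext j
  unfold sexticCoeff
  rw [formCoeff_eq 6 _ (sextic_homog _ _)]
  have hprod : (aeval (![1, Polynomial.X] : Fin 2 → Polynomial k)
      (∏ i : Fin 6, (C (μ * y i) * X 0 - C (μ * x i) * X 1) : MvPolynomial (Fin 2) k)) = f := by
    rw [h, ← hμ]
    simp only [map_prod, map_sub, map_mul, aeval_X, aeval_C, Matrix.cons_val_zero,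
      Matrix.cons_val_one, Polynomial.algebraMap_eq, Fin.prod_univ_six, map_pow]
    ring
  rw [hprod, hf, Polynomial.finsetSum_coeff]
  simp only [Polynomial.coeff_C_mul, Polynomial.coeff_X_pow]
  rw [Finset.sum_eq_single j]
  · simp
  · intro i _ hij
    rw [if_neg, mul_zero]
    intro h
    exact hij (Fin.ext h.symm)
  · simp

lemma act_sextic {k : Type*} [Field k] (M : Matrix (Fin 2) (Fin 2) k) (x y : Fin 6 → k) :
    actCoeff k 6 M (sexticCoeff x y) =
      sexticCoeff (fun i => M 1 1 * x i - M 0 1 * y i) (fun i => - M 1 0 * x i + M 0 0 * y i) := by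
  have h : toForm k 6 (sexticCoeff x y) = ∏ i : Fin 6, (C (y i) * X 0 - C (x i) * X 1) :=
    toForm_formCoeff 6 _ (sextic_homog x y)
  unfold actCoeff
  rw [h]
  have : matAct k M (∏ i : Fin 6, (C (y i) * X 0 - C (x i) * X 1)) =
      ∏ i : Fin 6, (C (- M 1 0 * x i + M 0 0 * y i) * X 0 - C (M 1 1 * x i - M 0 1 * y i) * X 1) := by
    unfold matAct
    rw [map_prod]
    apply Finset.prod_congr rfl
    intro i _
    simp only [map_sub, map_mul, map_add, map_neg, aeval_X, aeval_C, algebraMap_eq]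
    ring
  rw [this]
  rfl

lemma sextic_perm {k : Type*} [Field k] (x y : Fin 6 → k) (σ : Equiv.Perm (Fin 6)) :
    sexticCoeff (x ∘ σ) (y ∘ σ) = sexticCoeff x y := by
  funext j
  have h := Equiv.prod_comp σ
    (fun i => (C (y i) * X 0 - C (x i) * X 1 : MvPolynomial (Fin 2) k))
  unfold sexticCoeff
  rw [← h]
  simp only [Function.comp_apply]

lemma sextic_scale {k : Type*} [Field k] (x y l : Fin 6 → k) (hl : ∏ i, l i = 1) :
    sexticCoeff (fun i => l i * x i) (fun i => l i * y i) = sexticCoeff x y := by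
  funext j
  unfold sexticCoeff
  have : ∀ i, (C (l i * y i) * X 0 - C (l i * x i) * X 1 : MvPolynomial (Fin 2) k) =
      C (l i) * (C (y i) * X 0 - C (x i) * X 1) := by
    intro i
    simp only [map_mul]
    ring
  simp only [this]
  rw [Finset.prod_mul_distrib, ← map_prod, hl, map_one, one_mul]

lemma inv_scale {k : Type*} [Field k] (x y x' y' : Fin 6 → k) (c : k)
    (hD : ∀ i j, Dij x' y' i j = c * Dij x y i j) :
    sumPairs x' y' = c^6 * sumPairs x y ∧ sumB x' y' = c^12 * sumB x y ∧
    sumC x' y' = c^18 * sumC x y ∧ I10r x' y' = c^30 * I10r x y := by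
  refine ⟨?_, ?_, ?_, ?_⟩
  · unfold sumPairs
    rw [mul_left_comm]
    congr 1
    rw [Finset.mul_sum]
    apply Finset.sum_congr rfl
    intro σ _
    simp only [hD]
    ring
  · unfold sumB
    rw [mul_left_comm]
    congr 1
    rw [Finset.mul_sum]
    apply Finset.sum_congr rfl
    intro σ _
    simp only [hD]
    ring
  · unfold sumC
    rw [mul_left_comm]
    congr 1
    rw [Finset.mul_sum]
    apply Finset.sum_congr rfl
    intro σ _
    simp only [hD]
    ring
  · rw [I10r_eq, I10r_eq]
    unfold eD
    simp only [hD]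
    ring

lemma backward {k : Type*} [Field k] [IsAlgClosed k]
    (h2 : (2 : k) ≠ 0) (h3 : (3 : k) ≠ 0) (x y x' y' : Fin 6 → k)
    (h : I10r x y ≠ 0) (h' : I10r x' y' ≠ 0)
    (hperm : ∀ σ : Equiv.Perm (Fin 6), I10r (x' ∘ σ) (y' ∘ σ) ≠ 0) (R : k) (hR : R ≠ 0)
    (hA : sumPairs x y = R^2 * sumPairs x' y') (hB : sumB x y = R^4 * sumB x' y')
    (hC : sumC x y = R^6 * sumC x' y') (hDD : eD (Dij x y) = R^5 * eD (Dij x' y')) :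
    ∃ M : GL (Fin 2) k, actCoeff k 6 (M : Matrix (Fin 2) (Fin 2) k) (sexticCoeff x y) =
      sexticCoeff x' y' := by
  haveI : Infinite k := IsAlgClosed.instInfinite
  have h27 : (27 : k) ≠ 0 := by
    have : (27 : k) = 3 ^ 3 := by norm_num
    rw [this]
    exact pow_ne_zero 3 h3
  have s1 := sexticId_main h2 h3 x y h
  have s2 := sexticId_main h2 h3 x' y' h'
  obtain ⟨τ, hτ⟩ := exists_perm_of_prod (Jb (Dij x y)) (fun i => R * Jb (Dij x' y') i) (by
    intro T
    apply mul_left_cancel₀ h27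
    have e1 := s1 T
    have e2 := s2 (R⁻¹ * T)
    obtain ⟨U, rfl⟩ : ∃ U, T = R * U := ⟨R⁻¹ * T, by field_simp⟩
    rw [inv_mul_cancel_left₀ hR] at e2
    rw [e1, hA, hB, hC, hDD]
    linear_combination (-R^6) * e2)
  obtain ⟨σ, ε, hε, hJ⟩ := JPerm_all k τ
  obtain ⟨p, q, r, s, l, hdet, hl, hpq⟩ := proj_equiv h2 x y (x' ∘ σ) (y' ∘ σ) h (hperm σ) (R * ε) (by
    intro i
    rw [hτ i, hJ]
    have : ε * ε = 1 := by rcases hε with rfl | rfl <;> ring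
    linear_combination (-R * Jb (Dij x' y') (τ i)) * this)
  refine ⟨Matrix.GeneralLinearGroup.mkOfDetNeZero !![s, -q; -r, p] ?_, ?_⟩
  · rw [Matrix.det_fin_two_of]
    intro h0
    apply hdet
    linear_combination h0
  · rw [act_sextic]
    have e1 : (fun i => p * x i - -q * y i) = fun i => l i * (x' ∘ σ) i := by
      funext i
      rw [← (hpq i).1]
      ring
    have e2 : (fun i => - -r * x i + s * y i) = fun i => l i * (y' ∘ σ) i := by
      funext i
      rw [← (hpq i).2]
      ring
    have key : sexticCoeff (fun i => p * x i - -q * y i) (fun i => - -r * x i + s * y i) =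
        sexticCoeff x' y' := by
      rw [e1, e2, sextic_scale _ _ _ hl, sextic_perm]
    simpa [Matrix.GeneralLinearGroup.mkOfDetNeZero] using key

/-- Clebsch–Bolza–Igusa: two binary sextics with nonzero discriminant are
`GL₂(k)`-conjugate iff their basic invariants agree up to the scaling
`I_{2i} ↦ r^{2i} I_{2i}` for some `r ≠ 0`. -/
theorem clebsch_bolza_igusa
    (k : Type*) [Field k] [IsAlgClosed k]
    (h2 : (2 : k) ≠ 0) (h3 : (3 : k) ≠ 0) (h5 : (5 : k) ≠ 0)
    (P2 P4 P6 P10 : MvPolynomial (Fin 7) k)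
    (hh2 : P2.IsHomogeneous 2) (hh4 : P4.IsHomogeneous 4)
    (hh6 : P6.IsHomogeneous 6) (hh10 : P10.IsHomogeneous 10)
    (hi2 : SL2Invariant k 6 P2) (hi4 : SL2Invariant k 6 P4)
    (hi6 : SL2Invariant k 6 P6) (hi10 : SL2Invariant k 6 P10)
    (he2 : ∀ x y : Fin 6 → k, eval (sexticCoeff x y) P2 = I2r x y)
    (he4 : ∀ x y : Fin 6 → k, eval (sexticCoeff x y) P4 = I4r x y)
    (he6 : ∀ x y : Fin 6 → k, eval (sexticCoeff x y) P6 = I6r x y)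
    (he10 : ∀ x y : Fin 6 → k, eval (sexticCoeff x y) P10 = I10r x y)
    (a b : Fin 7 → k) (hda : eval a P10 ≠ 0) (hdb : eval b P10 ≠ 0) :
    (∃ M : GL (Fin 2) k, actCoeff k 6 (M : Matrix (Fin 2) (Fin 2) k) a = b) ↔
    (∃ r : k, r ≠ 0 ∧
      eval a P2 = r^2 * eval b P2 ∧
      eval a P4 = r^4 * eval b P4 ∧
      eval a P6 = r^6 * eval b P6 ∧
      eval a P10 = r^10 * eval b P10) := by
  obtain ⟨x, y, rfl⟩ := exists_sextic a
  constructor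
  · rintro ⟨M, rfl⟩
    set c : k := (M : Matrix (Fin 2) (Fin 2) k).det with hc
    have hc0 : c ≠ 0 := M.det_ne_zero
    rw [act_sextic]
    rw [he2, he2, he4, he4, he6, he6, he10, he10]
    obtain ⟨eA', eB', eC', eD'⟩ := inv_scale x y
      (fun i => (M : Matrix (Fin 2) (Fin 2) k) 1 1 * x i - (M : Matrix (Fin 2) (Fin 2) k) 0 1 * y i)
      (fun i => - (M : Matrix (Fin 2) (Fin 2) k) 1 0 * x i +
        (M : Matrix (Fin 2) (Fin 2) k) 0 0 * y i) c (by
        intro i j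
        rw [hc, Matrix.det_fin_two]
        unfold Dij
        ring)
    refine ⟨(c^3)⁻¹, inv_ne_zero (pow_ne_zero 3 hc0), ?_, ?_, ?_, ?_⟩
    · unfold I2r
      rw [eA']
      field_simp
    · unfold I4r I2r
      rw [eA', eB']
      field_simp
    · unfold I6r I4r I2r
      rw [eA', eB', eC']
      have : ((c^3)⁻¹)^6 * c^18 = 1 := by
        rw [inv_pow, ← pow_mul, inv_mul_cancel₀ (pow_ne_zero _ hc0)]
      linear_combination (-((13/108 : k) * (-(2 : k)⁻¹ * sumPairs x y)^3 -
        (1/108 : k) * (-(2 : k)⁻¹ * sumPairs x y) *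
          (9 * (-(2 : k)⁻¹ * sumPairs x y)^2 - 80 * sumB x y) + (25/9 : k) * sumC x y)) * this
    · rw [eD']
      field_simp
  · rintro ⟨r, hr, e2, e4, e6, e10⟩
    obtain ⟨x', y', rfl⟩ := exists_sextic b
    have hperm : ∀ σ : Equiv.Perm (Fin 6), I10r (x' ∘ σ) (y' ∘ σ) ≠ 0 := by
      intro σ
      rw [← he10, sextic_perm]
      exact hdb
    rw [he10] at hda hdb
    rw [he2, he2] at e2
    rw [he4, he4] at e4
    rw [he6, he6] at e6
    rw [he10, he10, I10r_eq, I10r_eq] at e10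
    have h80 : (80 : k) ≠ 0 := by
      have : (80 : k) = 2 ^ 4 * 5 := by norm_num
      rw [this]
      exact mul_ne_zero (pow_ne_zero 4 h2) h5
    have h9 : (25 / 9 : k) ≠ 0 := by
      have : (25 / 9 : k) = 5 ^ 2 / 3 ^ 2 := by norm_num
      rw [this]
      exact div_ne_zero (pow_ne_zero 2 h5) (pow_ne_zero 2 h3)
    have hA : sumPairs x y = r^2 * sumPairs x' y' := by
      unfold I2r at e2
      apply mul_left_cancel₀ (neg_ne_zero.mpr (inv_ne_zero h2))
      rw [e2]
      ring
    have hB : sumB x y = r^4 * sumB x' y' := by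
      apply mul_left_cancel₀ h80
      unfold I4r at e4
      rw [e2] at e4
      linear_combination - e4
    have hC : sumC x y = r^6 * sumC x' y' := by
      apply mul_left_cancel₀ h9
      unfold I6r at e6
      rw [e2, e4] at e6
      linear_combination e6
    have hsq : eD (Dij x y) ^ 2 = (r^5 * eD (Dij x' y')) ^ 2 := by
      rw [e10]
      ring
    rcases sq_eq_sq_iff_eq_or_eq_neg.mp hsq with h | h
    · exact backward h2 h3 x y x' y' hda hdb hperm r hr hA hB hC h
    · refine backward h2 h3 x y x' y' hda hdb hperm (-r) (neg_ne_zero.mpr hr) ?_ ?_ ?_ ?_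
      · rw [hA]; ring
      · rw [hB]; ring
      · rw [hC]; ring
      · rw [h]; ring
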